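/- Let E : C(S¹,ℂ) → ℂ be an analytic function (in the sense of analytic maps between complex Banach spaces) which is additive, i.e. E(x+y) = E(x) + E(y) whenever supp x ∩ supp y = ∅. Suppose z₁,…,z_N ∈ C(S¹,ℂ) (N ≥ 2) are such that no point of S¹ is contained in the support of more than two of the z_j. Then E(Σ_{j=1}^N z_j) = Σ_{1 ≤ i < j ≤ N} E(z_i + z_j) − (N − 2) Σ_{j=1}^N E(z_j). -/

import Mathlib

open MeasureTheory

/-- An alternating sum over all subsets vanishes if the summand does not depend on whether
`j` belongs to the subset. -/
theorem Finset.sum_neg_one_pow_card_smul_eq_zero {ι G : Type*} [Fintype ι] [DecidableEq ι]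
    [AddCommGroup G] (f : Finset ι → G) (j : ι)
    (hf : ∀ T : Finset ι, j ∉ T → f (insert j T) = f T) :
    ∑ T : Finset ι, (-1 : ℤ) ^ T.card • f T = 0 := by
  rw [← Finset.powerset_univ, ← Finset.insert_erase (Finset.mem_univ j),
    Finset.sum_powerset_insert (Finset.notMem_erase j _), ← Finset.sum_add_distrib]
  refine Finset.sum_eq_zero fun T hT => ?_
  have hj : j ∉ T := fun h => Finset.notMem_erase j _ (Finset.mem_powerset.1 hT h)
  rw [Finset.card_insert_of_notMem hj, hf T hj, pow_succ]
  simp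

/-- The polarization formula for symmetric multilinear maps. -/
theorem MultilinearMap.sum_neg_one_pow_card_smul_map_sum {R V G ι : Type*} [CommSemiring R]
    [AddCommMonoid V] [Module R V] [AddCommGroup G] [Module R G] [Fintype ι] [DecidableEq ι]
    (M : MultilinearMap R (fun _ : ι => V) G)
    (hM : ∀ (v : ι → V) (σ : Equiv.Perm ι), M (v ∘ σ) = M v) (w : ι → V) :
    ∑ T : Finset ι, (-1 : ℤ) ^ T.card • M (fun _ => ∑ i ∈ T, w i) =
      (-1 : ℤ) ^ Fintype.card ι • (Fintype.card ι).factorial • M w := by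
  have expand (T : Finset ι) : M (fun _ => ∑ i ∈ T, w i) =
      ∑ r : ι → ι, if ∀ k, r k ∈ T then M (w ∘ r) else 0 := by
    rw [M.map_sum_finset (fun _ => w) (fun _ => T), ← Finset.sum_filter]
    refine Finset.sum_congr ?_ fun _ _ => rfl
    ext r
    simp
  simp_rw [expand, Finset.smul_sum]
  rw [Finset.sum_comm]
  have bij (σ : Equiv.Perm ι) : ∑ T : Finset ι, (-1 : ℤ) ^ T.card •
      (if ∀ k, σ k ∈ T then M (w ∘ σ) else 0) = (-1 : ℤ) ^ Fintype.card ι • M w := by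
    rw [Finset.sum_eq_single Finset.univ]
    · simp [hM]
    · intro T _ hT
      rw [if_neg, smul_zero]
      intro h
      exact hT (Finset.eq_univ_of_forall fun i => by simpa using h (σ.symm i))
    · simp
  have nonbij (r : ι → ι) (hr : ¬ Function.Bijective r) : ∑ T : Finset ι, (-1 : ℤ) ^ T.card •
      (if ∀ k, r k ∈ T then M (w ∘ r) else 0) = 0 := by
    rw [← Finite.surjective_iff_bijective, Function.Surjective] at hr
    push Not at hr
    obtain ⟨j, hj⟩ := hr
    refine Finset.sum_neg_one_pow_card_smul_eq_zero _ j fun T _ => ?_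
    simp [hj]
  rw [← Finset.sum_filter_of_ne (p := Function.Bijective)
    fun r _ h => by_contra fun hr => h (nonbij r hr)]
  rw [← Fintype.card_perm, smul_comm, ← Finset.card_univ, ← Finset.sum_const]
  refine Finset.sum_bij' (fun r hr => Equiv.ofBijective r (Finset.mem_filter.1 hr).2)
    (fun σ _ => σ) (by simp) (fun σ _ => by simp) (fun _ _ => rfl)
    (fun σ _ => by ext; rfl) fun r hr => bij (Equiv.ofBijective r (Finset.mem_filter.1 hr).2)

/-- A symmetric multilinear map vanishes at `w` if its diagonal is additive with respect to a
nontrivial splitting of the family `w`. -/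
theorem MultilinearMap.eq_zero_of_diagonal_splits {R V G ι : Type*} [CommSemiring R]
    [AddCommMonoid V] [Module R V] [AddCommGroup G] [IsAddTorsionFree G] [Module R G] [Fintype ι]
    [DecidableEq ι] (M : MultilinearMap R (fun _ : ι => V) G)
    (hM : ∀ (v : ι → V) (σ : Equiv.Perm ι), M (v ∘ σ) = M v) (w : ι → V)
    (S : Finset ι) {a b : ι} (ha : a ∈ S) (hb : b ∉ S)
    (hS : ∀ T : Finset ι, M (fun _ => ∑ i ∈ T, w i) =
      M (fun _ => ∑ i ∈ T ∩ S, w i) + M (fun _ => ∑ i ∈ T \ S, w i)) :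
    M w = 0 := by
  have key := M.sum_neg_one_pow_card_smul_map_sum hM w
  rw [Finset.sum_congr rfl fun T _ => by rw [hS T, smul_add]] at key
  rw [Finset.sum_add_distrib,
    Finset.sum_neg_one_pow_card_smul_eq_zero (fun T => M fun _ => ∑ i ∈ T ∩ S, w i) b
      (fun T _ => by simp [Finset.insert_inter_of_notMem hb]),
    Finset.sum_neg_one_pow_card_smul_eq_zero (fun T => M fun _ => ∑ i ∈ T \ S, w i) a
      (fun T _ => by simp [Finset.insert_sdiff_of_mem _ ha]), add_zero] at key
  rcases neg_one_pow_eq_or ℤ (Fintype.card ι) with h | h <;>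
    simpa [h, Nat.factorial_ne_zero] using key.symm

/-- The Taylor coefficients of `t ↦ f (t • x)` at the origin. -/
theorem ContDiff.iteratedDeriv_comp_smul_zero {V G : Type*} [NormedAddCommGroup V]
    [NormedSpace ℂ V] [NormedAddCommGroup G] [NormedSpace ℂ G] {f : V → G} {n : ℕ}
    (hf : ContDiff ℂ n f) (x : V) :
    iteratedDeriv n (fun t : ℂ => f (t • x)) 0 = iteratedFDeriv ℂ n f 0 fun _ => x := by
  have h := (ContinuousLinearMap.toSpanSingleton ℂ x).iteratedFDeriv_comp_right hf 0 le_rfl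
  rw [iteratedDeriv_eq_iteratedFDeriv]
  change iteratedFDeriv ℂ n (f ∘ ContinuousLinearMap.toSpanSingleton ℂ x) 0 _ = _
  rw [h]
  simp

theorem ContDiff.hasSum_iteratedFDeriv_zero {V G : Type*} [NormedAddCommGroup V]
    [NormedSpace ℂ V] [NormedAddCommGroup G] [NormedSpace ℂ G] [CompleteSpace G] {f : V → G}
    (hf : ContDiff ℂ ⊤ f) (x : V) :
    HasSum (fun n : ℕ => (n.factorial : ℂ)⁻¹ • iteratedFDeriv ℂ n f 0 fun _ => x) (f x) := by
  have hd : Differentiable ℂ fun t : ℂ => f (t • x) :=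
    (hf.differentiable (by simp)).comp (differentiable_id.smul_const x)
  have h := Complex.hasSum_taylorSeries_of_entire hd 0 1
  simpa [(hf.of_le le_top).iteratedDeriv_comp_smul_zero] using h

theorem ContinuousMap.tsupport_sum_subset {X ι : Type*} [TopologicalSpace X] (s : Finset ι) (w : ι → C(X, ℂ)) :
    tsupport ⇑(∑ i ∈ s, w i) ⊆ ⋃ i ∈ s, tsupport ⇑(w i) := by
  refine closure_minimal (fun t ht => ?_)
    (s.finite_toSet.isClosed_biUnion fun i _ => isClosed_tsupport _)
  rw [Function.mem_support, ContinuousMap.coe_sum, Finset.sum_apply] at ht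
  obtain ⟨i, hi, h⟩ := Finset.exists_ne_zero_of_sum_ne_zero ht
  exact Set.mem_biUnion hi (subset_tsupport _ h)

section Additive

variable {X : Type*} [TopologicalSpace X] [CompactSpace X]

/-- The homogeneous components of an additive analytic function are additive. -/
theorem iteratedFDeriv_diagonal_add {E : C(X, ℂ) → ℂ} (hE : ContDiff ℂ ⊤ E)
    (hadd : ∀ x y : C(X, ℂ), tsupport ⇑x ∩ tsupport ⇑y = ∅ → E (x + y) = E x + E y)
    (n : ℕ) {x y : C(X, ℂ)} (hxy : tsupport ⇑x ∩ tsupport ⇑y = ∅) :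
    (iteratedFDeriv ℂ n E 0 fun _ => x + y) =
      (iteratedFDeriv ℂ n E 0 fun _ => x) + iteratedFDeriv ℂ n E 0 fun _ => y := by
  have hn : ContDiff ℂ n E := hE.of_le le_top
  have hc (x : C(X, ℂ)) : ContDiff ℂ n fun t : ℂ => E (t • x) :=
    hn.comp (contDiff_id.smul contDiff_const)
  simp_rw [← hn.iteratedDeriv_comp_smul_zero]
  rw [← iteratedDeriv_add (hc x).contDiffAt (hc y).contDiffAt]
  congr 1
  ext t
  rw [smul_add, Pi.add_apply]
  refine hadd _ _ (Set.subset_eq_empty (Set.inter_subset_inter ?_ ?_) hxy) <;>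
    exact tsupport_smul_subset_right (fun _ => t) _

/-- The derivatives at the origin of an additive analytic function vanish on families which split
into two nonempty parts with disjoint supports. -/
theorem iteratedFDeriv_eq_zero_of_splits {E : C(X, ℂ) → ℂ} (hE : ContDiff ℂ ⊤ E)
    (hadd : ∀ x y : C(X, ℂ), tsupport ⇑x ∩ tsupport ⇑y = ∅ → E (x + y) = E x + E y)
    {n : ℕ} (w : Fin n → C(X, ℂ)) (S : Finset (Fin n)) {a b : Fin n} (ha : a ∈ S) (hb : b ∉ S)
    (hS : ∀ i ∈ S, ∀ j ∉ S, Disjoint (tsupport ⇑(w i)) (tsupport ⇑(w j))) :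
    iteratedFDeriv ℂ n E 0 w = 0 := by
  refine (iteratedFDeriv ℂ n E 0).toMultilinearMap.eq_zero_of_diagonal_splits
    (fun v σ => hE.contDiffAt.iteratedFDeriv_comp_perm v σ) w S ha hb fun T => ?_
  rw [← Finset.sum_inter_add_sum_sdiff T S w]
  refine iteratedFDeriv_diagonal_add hE hadd n (Set.disjoint_iff_inter_eq_empty.1 ?_)
  refine Set.disjoint_of_subset (ContinuousMap.tsupport_sum_subset _ _)
    (ContinuousMap.tsupport_sum_subset _ _) ?_
  simp only [Set.disjoint_iUnion_left, Set.disjoint_iUnion_right]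
  intro i hi j hj
  exact hS j (Finset.mem_inter.1 hj).2 i (Finset.mem_sdiff.1 hi).2
end Additive

/-- A compact metric space carries finite partitions of unity with arbitrarily fine supports. -/
theorem exists_fine_partition_of_unity (X : Type*) [MetricSpace X] [CompactSpace X] {ε : ℝ}
    (hε : 0 < ε) : ∃ (s : Finset X) (χ : s → C(X, ℝ)), ∑ k, χ k = 1 ∧
      ∀ k, ∀ p ∈ tsupport ⇑(χ k), ∀ q ∈ tsupport ⇑(χ k), dist p q < ε := by
  obtain ⟨t, -, htf, ht⟩ := (isCompact_univ (X := X)).finite_cover_balls (half_pos hε)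
  lift t to Finset X using htf
  obtain ⟨f, hf⟩ := PartitionOfUnity.exists_isSubordinate isClosed_univ
    (fun k : t => Metric.ball (k : X) (ε / 2)) (fun _ => Metric.isOpen_ball)
    (by simpa [Set.iUnion_subtype] using ht)
  refine ⟨t, fun k => f k, ?_, fun k p hp q hq => ?_⟩
  · ext x
    rw [ContinuousMap.coe_sum, Finset.sum_apply, ← finsum_eq_sum_of_fintype]
    exact f.sum_eq_one (Set.mem_univ x)
  · have h1 := Metric.mem_ball.1 (hf k hp)
    have h2 := Metric.mem_ball'.1 (hf k hq)
    linarith [dist_triangle p k q]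

/-- The derivatives at the origin of an additive analytic function vanish on families of functions
whose supports have no common point. -/
theorem iteratedFDeriv_eq_zero_of_iInter_tsupport_eq_empty {X : Type*} [MetricSpace X]
    [CompactSpace X] {E : C(X, ℂ) → ℂ} (hE : ContDiff ℂ ⊤ E)
    (hadd : ∀ x y : C(X, ℂ), tsupport ⇑x ∩ tsupport ⇑y = ∅ → E (x + y) = E x + E y)
    {n : ℕ} [NeZero n] (w : Fin n → C(X, ℂ)) (hw : ⋂ i, tsupport ⇑(w i) = ∅) :
    iteratedFDeriv ℂ n E 0 w = 0 := by
  classical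
  obtain ⟨δ, hδ, hball⟩ := lebesgue_number_lemma_of_metric (isCompact_univ (X := X))
    (fun i => (isClosed_tsupport ⇑(w i)).isOpen_compl)
    (by rw [← Set.compl_iInter, hw, Set.compl_empty])
  have hn : (0 : ℝ) < n := Nat.cast_pos.2 (NeZero.pos n)
  set ε := δ / (2 * n) with hε_def
  have hε : 0 < ε := by positivity
  have hnε : n * (2 * ε) = δ := by rw [hε_def]; field_simp
  obtain ⟨s, χ, hχ, hfine⟩ := exists_fine_partition_of_unity X hε
  have hsplit : w = fun i => ∑ k, χ k • w i := by
    ext1 i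
    rw [← Finset.sum_smul, hχ, one_smul]
  rw [hsplit, ContinuousMultilinearMap.map_sum]
  refine Finset.sum_eq_zero fun r _ => ?_
  set v : Fin n → C(X, ℂ) := fun i => χ (r i) • w i
  by_cases hv : ∃ i, v i = 0
  · exact hv.elim fun i hi => ContinuousMultilinearMap.map_coord_zero _ i hi
  have hp (i : Fin n) : ∃ p, v i p ≠ 0 := by
    by_contra! h
    exact hv ⟨i, ContinuousMap.ext h⟩
  choose p hp using hp
  have hχv (i : Fin n) : tsupport ⇑(v i) ⊆ tsupport ⇑(χ (r i)) :=
    tsupport_smul_subset_left _ _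
  have hpv (i : Fin n) : p i ∈ tsupport ⇑(v i) := subset_tsupport _ (hp i)
  let G : SimpleGraph (Fin n) :=
    SimpleGraph.fromRel fun i j => ¬ Disjoint (tsupport ⇑(v i)) (tsupport ⇑(v j))
  have adj_dist {i j : Fin n} (h : G.Adj i j) : dist (p i) (p j) ≤ 2 * ε := by
    have h' : ¬ Disjoint (tsupport ⇑(v i)) (tsupport ⇑(v j)) := by
      rcases ((SimpleGraph.fromRel_adj _ _ _).1 h).2 with h | h
      · exact h
      · exact fun h' => h h'.symm
    obtain ⟨q, hqi, hqj⟩ := Set.not_disjoint_iff.1 h'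
    have h1 := hfine _ _ (hχv i (hpv i)) q (hχv i hqi)
    have h2 := hfine _ q (hχv j hqj) _ (hχv j (hpv j))
    linarith [dist_triangle (p i) q (p j)]
  have walk_dist {i j : Fin n} (W : G.Walk i j) : dist (p i) (p j) ≤ W.length * (2 * ε) := by
    induction W with
    | nil => simp
    | @cons a b c h W ih =>
      rw [SimpleGraph.Walk.length_cons, Nat.cast_succ]
      linarith [dist_triangle (p a) (p b) (p c), adj_dist h]
  by_cases hconn : ∀ i, G.Reachable 0 i
  · obtain ⟨i, hi⟩ := hball (p 0) (Set.mem_univ _)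
    obtain ⟨W, hW⟩ := (hconn i).exists_isPath
    have hlen : (W.length : ℝ) < n := by exact_mod_cast hW.length_lt.trans_eq (Fintype.card_fin n)
    refine absurd (tsupport_smul_subset_right (χ (r i)) (w i) (hpv i)) (hi ?_)
    rw [Metric.mem_ball']
    calc dist (p 0) (p i) ≤ W.length * (2 * ε) := walk_dist W
      _ < n * (2 * ε) := by gcongr
      _ = δ := hnε
  · push Not at hconn
    obtain ⟨b, hb⟩ := hconn
    refine iteratedFDeriv_eq_zero_of_splits hE hadd v
      (Finset.univ.filter fun i => G.Reachable 0 i) (a := 0) (b := b) (by simp) (by simpa using hb)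
      fun i hi j hj => ?_
    rw [Finset.mem_filter_univ] at hi hj
    by_contra h
    refine hj (hi.trans (SimpleGraph.Adj.reachable ?_))
    exact (SimpleGraph.fromRel_adj _ _ _).2 ⟨fun hij => hj (hij ▸ hi), Or.inl h⟩

theorem Fin.sum_pairs_ite_mem {N : ℕ} (c : Fin N) :
    (∑ i, ∑ j ∈ Finset.univ.filter (fun j => i < j), if c = i ∨ c = j then (1 : ℂ) else 0) =
      N - 1 := by
  have h (i j : Fin N) (hij : i < j) : (if c = i ∨ c = j then (1 : ℂ) else 0) =
      (if c = i then 1 else 0) + if c = j then 1 else 0 := by grind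
  have h1 : (∑ i, ∑ j ∈ Finset.univ.filter (fun j => i < j), if c = i then (1 : ℂ) else 0) =
      (N - 1 - c : ℕ) := by
    rw [Finset.sum_eq_single c (fun b _ hb => by simp [hb.symm]) (by simp)]
    simp [Finset.filter_lt_eq_Ioi]
  have h2 : (∑ i, ∑ j ∈ Finset.univ.filter (fun j => i < j), if c = j then (1 : ℂ) else 0) =
      (c : ℕ) := by
    simp [Finset.filter_gt_eq_Iio]
  rw [Finset.sum_congr rfl fun i _ => Finset.sum_congr rfl fun j hj =>
    h i j (Finset.mem_filter.1 hj).2]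
  simp_rw [Finset.sum_add_distrib]
  rw [h1, h2, ← Nat.cast_add, show N - 1 - (c : ℕ) + c = N - 1 by omega,
    Nat.cast_pred c.pos]

/-- The number of pairs containing the range of `r`, minus `N - 2` times the number of singletons
containing it, is one when the range has at most two elements. -/
theorem Fin.pairs_sub_singletons_eq_one {ι : Type*} [Fintype ι] [Nonempty ι] {N : ℕ}
    (r : ι → Fin N)
    (hr : ¬ ∃ a b c, r a ≠ r b ∧ r b ≠ r c ∧ r a ≠ r c) :
    (∑ i, ∑ j ∈ Finset.univ.filter (fun j => i < j),
        if ∀ k, r k = i ∨ r k = j then (1 : ℂ) else 0)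
      - ((N : ℂ) - 2) * (∑ j, if ∀ k, r k = j then (1 : ℂ) else 0) = 1 := by
  obtain ⟨a⟩ := ‹Nonempty ι›
  by_cases hc : ∀ k, r k = r a
  · simp_rw [hc]
    have : Nonempty ι := ⟨a⟩
    simp only [forall_const]
    rw [Fin.sum_pairs_ite_mem]
    simp
    ring
  · push Not at hc
    obtain ⟨b, hb⟩ := hc
    have hs : (∑ j, if ∀ k, r k = j then (1 : ℂ) else 0) = 0 :=
      Finset.sum_eq_zero fun j _ => if_neg fun h => hb (by rw [h a, h b])
    rw [hs, mul_zero, sub_zero]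
    obtain ⟨c, d, hcd⟩ : ∃ c d, r c < r d := by
      rcases lt_or_gt_of_ne hb with h | h
      exacts [⟨b, a, h⟩, ⟨a, b, h⟩]
    have hcov (k : ι) : r k = r c ∨ r k = r d := by
      by_contra! h
      exact hr ⟨k, c, d, h.1, hcd.ne, h.2⟩
    have hiff (i j : Fin N) (hij : i < j) :
        (∀ k, r k = i ∨ r k = j) ↔ i = r c ∧ j = r d := by
      refine ⟨fun h => ?_, fun h k => by rw [h.1, h.2]; exact hcov k⟩
      have h1 := h c
      have h2 := h d
      grind
    rw [Finset.sum_eq_single (r c), Finset.sum_eq_single (r d)]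
    · simp [hiff _ _ hcd]
    · intro j hj hjd
      exact if_neg fun h => hjd ((hiff _ _ (Finset.mem_filter.1 hj).2).1 h).2
    · simp [hcd]
    · intro i _ hic
      exact Finset.sum_eq_zero fun j hj =>
        if_neg fun h => hic ((hiff _ _ (Finset.mem_filter.1 hj).2).1 h).1
    · simp

/-- A multilinear map which vanishes on all families drawn from `z` with at least three distinct
indices satisfies the pair expansion along the diagonal. -/
theorem MultilinearMap.map_sum_eq_sum_pairs {ι V : Type*} [Fintype ι] [Nonempty ι]
    [AddCommMonoid V] [Module ℂ V] (M : MultilinearMap ℂ (fun _ : ι => V) ℂ) {N : ℕ}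
    (z : Fin N → V)
    (hM : ∀ r : ι → Fin N, (∃ a b c, r a ≠ r b ∧ r b ≠ r c ∧ r a ≠ r c) → M (z ∘ r) = 0) :
    M (fun _ => ∑ j, z j) =
      (∑ i, ∑ j ∈ Finset.univ.filter (fun j => i < j), M fun _ => z i + z j)
        - ((N : ℂ) - 2) * ∑ j, M fun _ => z j := by
  classical
  have expand (T : Finset (Fin N)) : M (fun _ => ∑ i ∈ T, z i) =
      ∑ r : ι → Fin N, (if ∀ k, r k ∈ T then 1 else 0) * M (z ∘ r) := by
    rw [M.map_sum_finset (fun _ => z) (fun _ => T)]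
    simp_rw [ite_mul, one_mul, zero_mul]
    rw [← Finset.sum_filter]
    refine Finset.sum_congr ?_ fun _ _ => rfl
    ext r
    simp
  have pair (i j : Fin N) (hij : i < j) : M (fun _ => z i + z j) =
      ∑ r : ι → Fin N, (if ∀ k, r k = i ∨ r k = j then 1 else 0) * M (z ∘ r) := by
    simpa [Finset.sum_pair hij.ne] using expand {i, j}
  have single (j : Fin N) : M (fun _ => z j) =
      ∑ r : ι → Fin N, (if ∀ k, r k = j then 1 else 0) * M (z ∘ r) := by
    simpa using expand {j}
  rw [expand, Finset.sum_congr rfl fun i _ => Finset.sum_congr rfl fun j hj =>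
    pair i j (Finset.mem_filter.1 hj).2, Finset.sum_congr rfl fun j _ => single j]
  rw [Finset.sum_congr rfl fun i _ => Finset.sum_comm, Finset.sum_comm,
    Finset.sum_comm (s := Finset.univ (α := Fin N)), Finset.mul_sum, ← Finset.sum_sub_distrib]
  refine Finset.sum_congr rfl fun r _ => ?_
  simp_rw [← Finset.sum_mul]
  rw [← mul_assoc, ← sub_mul]
  by_cases hr : ∃ a b c, r a ≠ r b ∧ r b ≠ r c ∧ r a ≠ r c
  · simp [hM r hr]
  · rw [Fin.pairs_sub_singletons_eq_one r hr]
    simp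

/-- Formula (5.2) of Lemma 5.2: if `E` is an additive analytic function on `C(S¹, ℂ)`
and no point of `S¹` lies in the support of more than two of `z₁, …, z_N`, then
`E(Σ z_j) = Σ_{i<j} E(z_i + z_j) − (N−2) Σ_j E(z_j)`. -/
theorem additive_analytic_sum_formula
    (E : C(AddCircle (1 : ℝ), ℂ) → ℂ)
    (hE : ∀ x, AnalyticAt ℂ E x)
    (hadd : ∀ x y : C(AddCircle (1 : ℝ), ℂ),
      tsupport ⇑x ∩ tsupport ⇑y = ∅ → E (x + y) = E x + E y)
    (N : ℕ) (hN : 2 ≤ N)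
    (z : Fin N → C(AddCircle (1 : ℝ), ℂ))
    (hsupp : ∀ i j k : Fin N, i ≠ j → j ≠ k → i ≠ k →
      tsupport ⇑(z i) ∩ tsupport ⇑(z j) ∩ tsupport ⇑(z k) = ∅) :
    E (∑ j, z j) =
      (∑ i, ∑ j ∈ Finset.univ.filter (fun j => i < j), E (z i + z j))
        - ((N : ℂ) - 2) * ∑ j, E (z j) := by
  have hE' : ContDiff ℂ ⊤ E := contDiff_iff_contDiffAt.2 fun x => (hE x).contDiffAt
  have : Fact ((0 : ℝ) < 1) := ⟨one_pos⟩
  have h0 : E 0 = 0 := by simpa using hadd 0 0 (by simp)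
  have hterm (n : ℕ) : (iteratedFDeriv ℂ n E 0 fun _ => ∑ j, z j) =
      (∑ i, ∑ j ∈ Finset.univ.filter (fun j => i < j), iteratedFDeriv ℂ n E 0 fun _ => z i + z j)
        - ((N : ℂ) - 2) * ∑ j, iteratedFDeriv ℂ n E 0 fun _ => z j := by
    rcases n.eq_zero_or_pos with rfl | hn
    · simp [h0]
    have : NeZero n := ⟨hn.ne'⟩
    refine (iteratedFDeriv ℂ n E 0).toMultilinearMap.map_sum_eq_sum_pairs z ?_
    rintro r ⟨a, b, c, hab, hbc, hac⟩
    refine iteratedFDeriv_eq_zero_of_iInter_tsupport_eq_empty hE' hadd _ ?_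
    refine Set.subset_eq_empty (fun t ht => ?_) (hsupp (r a) (r b) (r c) hab hbc hac)
    rw [Set.mem_iInter] at ht
    exact ⟨⟨ht a, ht b⟩, ht c⟩
  have hsum (x) := hE'.hasSum_iteratedFDeriv_zero x
  refine (hsum _).unique ?_
  simp_rw [hterm, smul_sub, Finset.smul_sum, ← mul_smul_comm, Finset.smul_sum]
  exact (hasSum_sum fun i _ => hasSum_sum fun j _ => hsum (z i + z j)).sub
    ((hasSum_sum fun j _ => hsum (z j)).mul_left _)
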